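/- arXiv:0906.5428 — 2 statements merged into one kernel-verified Lean document; each statement's English description precedes it below -/
import Mathlib

section
/- Let α be an irrational point in ℝ/ℤ and let β = (m p_{n−1} + p_{n−2})/(m q_{n−1} + q_{n−2}), with 1 ≤ m ≤ a_n, be a nonzero point of E_n(α) for some positive integer n. If n is odd, then β′ = p_{n−1}/q_{n−1}, β″ = ((m−1) p_{n−1} + p_{n−2})/((m−1) q_{n−1} + q_{n−2}), and α ∈ I(β′, β). If n is even, then β′ = ((m−1) p_{n−1} + p_{n−2})/((m−1) q_{n−1} + q_{n−2}), β″ = p_{n−1}/q_{n−1}, and α ∈ I(β, β″). -/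
open MeasureTheory Filter Set

noncomputable section

/-- The normalized sawtooth function `ψ(x) = x - ⌊x⌋ - 1/2` for non-integer `x`,
and `ψ(x) = 0` for integer `x`.  It is periodic with period 1. -/
def saw (x : ℝ) : ℝ := if Int.fract x = 0 then 0 else Int.fract x - 1/2

/-- For a rational `β = a/q` in lowest terms, the denominator `q'` of the left Farey
neighbour of `β` in the Farey fractions of order `q`:  the unique `q' ∈ {1, …, q-1}` with
`a * q' ≡ 1 (mod q)`. -/
def lden (β : ℚ) : ℕ := ((β.num : ZMod β.den)⁻¹).val

/-- The denominator `q''` of the right Farey neighbour of `β`:  the unique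
`q'' ∈ {1, …, q-1}` with `a * q'' ≡ -1 (mod q)`. -/
def rden (β : ℚ) : ℕ := (((-β.num : ℤ) : ZMod β.den)⁻¹).val

/-- The left Farey neighbour `β'` of `β`:  the unique point of `F_{h(β)}` such that
`{β', β}` are consecutive in `F_{h(β)}`.  Explicitly `β' = (a q' - 1)/(q q') = a'/q'`. -/
def lpt (β : ℚ) : ℚ := ((β.num * (lden β : ℤ) - 1 : ℤ) : ℚ) / ((β.den * lden β : ℕ) : ℚ)

/-- The right Farey neighbour `β''` of `β`:  the unique point of `F_{h(β)}` such that
`{β, β''}` are consecutive in `F_{h(β)}`.  Explicitly `β'' = (a q'' + 1)/(q q'') = a''/q''`.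
(For `β ∈ (0,1)` one has `β' ∈ [0,β)` and `β'' ∈ (β,1]`; the rational `1` represents
the zero coset of `ℚ/ℤ`.) -/
def rpt (β : ℚ) : ℚ := ((β.num * (rden β : ℤ) + 1 : ℤ) : ℚ) / ((β.den * rden β : ℕ) : ℚ)

/-- The function `f_β : ℝ/ℤ → ℝ` (realized as a 1-periodic function on `ℝ`), where
`β` ranges over rationals in `[0,1)` (representatives of `ℚ/ℤ`):  `f_0 ≡ 1` and, for
`β ≠ 0`, `f_β(x) = h(β) ψ(x-β) - h(β') ψ(x-β') - h(β'') ψ(x-β'')`, the height `h` of a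
rational being its reduced denominator. -/
def fb (β : ℚ) (x : ℝ) : ℝ :=
  if β = 0 then 1 else
    (β.den : ℝ) * saw (x - (β : ℝ)) - ((lpt β).den : ℝ) * saw (x - ((lpt β : ℚ) : ℝ))
      - ((rpt β).den : ℝ) * saw (x - ((rpt β : ℚ) : ℝ))

/-- The Farey fractions of order `Q` in `[0,1]` (both `0` and `1` represent the zero
coset of `ℚ/ℤ`). -/
def fareySet (Q : ℕ) : Set ℚ := {γ | 0 ≤ γ ∧ γ ≤ 1 ∧ γ.den ≤ Q}

/-- `{γ₁, γ₂}` are consecutive points of `F_Q`, i.e. `I(γ₁,γ₂) = (γ₁,γ₂)` is a component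
interval of `(ℝ/ℤ) ∖ F_Q`. -/
def consec (Q : ℕ) (γ₁ γ₂ : ℚ) : Prop :=
  γ₁ ∈ fareySet Q ∧ γ₂ ∈ fareySet Q ∧ γ₁ < γ₂ ∧ ∀ γ ∈ fareySet Q, γ ≤ γ₁ ∨ γ₂ ≤ γ

/-- The finite set `F_Q = {β ∈ ℚ/ℤ : h(β) ≤ Q}`, realized as the rationals in `[0,1)`
with denominator at most `Q`. -/
def fareyFin (Q : ℕ) : Finset ℚ :=
  ((Finset.range (Q+1) ×ˢ Finset.range (Q+1)).image fun p => (p.1 : ℚ) / (p.2 : ℚ)).filter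
    fun β => 0 ≤ β ∧ β < 1 ∧ β.den ≤ Q

/-- The Gauss map `x ↦ {1/x}`. -/
def gaussMap (x : ℝ) : ℝ := Int.fract x⁻¹

/-- `cfa α n` is the `n`-th partial quotient `a_n` of the continued fraction expansion
`α = [0; a₁, a₂, …]` of `α ∈ (0,1)` (with the convention `a₀ = 0`). -/
def cfa (α : ℝ) : ℕ → ℤ
  | 0 => 0
  | n+1 => ⌊(gaussMap^[n] α)⁻¹⌋

/-- `cfpq α (n+2) = (pₙ, qₙ)`, the numerators and denominators of the principal
convergents of `α`:  `p₋₂ = 0, q₋₂ = 1, p₋₁ = 1, q₋₁ = 0`,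
`pₙ = aₙ pₙ₋₁ + pₙ₋₂`, `qₙ = aₙ qₙ₋₁ + qₙ₋₂`. -/
def cfpq (α : ℝ) : ℕ → ℤ × ℤ
  | 0 => (0, 1)
  | 1 => (1, 0)
  | n+2 => (cfa α n * (cfpq α (n+1)).1 + (cfpq α n).1,
            cfa α n * (cfpq α (n+1)).2 + (cfpq α n).2)

/-- The element `(m pₙ₋₁ + pₙ₋₂)/(m qₙ₋₁ + qₙ₋₂)` of `E_n(α)`, reduced modulo 1 to the
representative in `[0,1)` of its coset in `ℚ/ℤ`. -/
def cfE (α : ℝ) (n : ℕ) (m : ℤ) : ℚ :=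
  Int.fract (((m * (cfpq α (n+1)).1 + (cfpq α n).1 : ℤ) : ℚ) /
             ((m * (cfpq α (n+1)).2 + (cfpq α n).2 : ℤ) : ℚ))

/-- `E_n(α) = {(m pₙ₋₁ + pₙ₋₂)/(m qₙ₋₁ + qₙ₋₂) : 1 ≤ m ≤ aₙ}`, the set of the `n`-th
principal convergent together with the intermediate convergents, as a finite set of
representatives in `[0,1)` of elements of `ℚ/ℤ`. -/
def cfEfin (α : ℝ) (n : ℕ) : Finset ℚ := (Finset.Icc 1 (cfa α n)).image (cfE α n)

/-- The left Farey neighbour of `a / q` is `c / d` as soon as `a * d - c * q = 1`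
and `0 ≤ d ≤ q`. -/
lemma lpt_div_eq {a q c d : ℤ} (hq : 2 ≤ q) (hd : 0 ≤ d) (hdq : d ≤ q)
    (h : a * d - c * q = 1) : lpt ((a : ℚ) / (q : ℚ)) = (c : ℚ) / (d : ℚ) := by
  have hcop : IsCoprime a q := ⟨d, -c, by linarith⟩
  have hnum : ((a : ℚ) / (q : ℚ)).num = a :=
    Rat.num_div_eq_of_coprime (by omega) (Int.isCoprime_iff_nat_coprime.mp hcop)
  have hden : (((a : ℚ) / (q : ℚ)).den : ℤ) = q :=
    Rat.den_div_eq_of_coprime (by omega) (Int.isCoprime_iff_nat_coprime.mp hcop)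
  have hd0 : d ≠ 0 := by
    rintro rfl
    have : q ∣ 1 := ⟨-c, by linarith⟩
    have := Int.le_of_dvd one_pos this
    omega
  have hdq' : d ≠ q := by
    rintro rfl
    have : d ∣ 1 := ⟨a - c, by linarith⟩
    have := Int.le_of_dvd one_pos this
    omega
  have hl : (lden ((a : ℚ) / (q : ℚ)) : ℤ) = d := by
    unfold lden
    rw [hnum]
    generalize ((a : ℚ) / (q : ℚ)).den = N at hden
    subst hden
    have hone : (a : ZMod N) * (d : ZMod N) = 1 := by
      have := congrArg (Int.cast : ℤ → ZMod N) h
      push_cast at this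
      simpa using this
    have : NeZero N := ⟨by omega⟩
    rw [ZMod.inv_eq_of_mul_eq_one N _ _ hone, ZMod.val_intCast]
    exact Int.emod_eq_of_lt hd (lt_of_le_of_ne hdq hdq')
  have hl' : (lden ((a : ℚ) / (q : ℚ)) : ℚ) = d := by exact_mod_cast hl
  have hden' : (((a : ℚ) / (q : ℚ)).den : ℚ) = q := by exact_mod_cast hden
  unfold lpt
  rw [hnum]
  push_cast
  rw [hl', hden']
  have hqQ : (q : ℚ) ≠ 0 := by exact_mod_cast (by omega : q ≠ 0)
  have hdQ : (d : ℚ) ≠ 0 := by exact_mod_cast hd0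
  have hQ : (a : ℚ) * d - c * q = 1 := by exact_mod_cast h
  rw [div_eq_div_iff (mul_ne_zero hqQ hdQ) hdQ]
  linear_combination (d : ℚ) * hQ

lemma rpt_eq_neg_lpt_neg (β : ℚ) : rpt β = -lpt (-β) := by
  unfold rpt lpt rden lden
  simp only [Rat.neg_num, Rat.neg_den]
  rw [← neg_div]
  push_cast
  ring

/-- The right Farey neighbour of `a / q` is `c / d` as soon as `c * q - a * d = 1`
and `0 ≤ d ≤ q`. -/
lemma rpt_div_eq {a q c d : ℤ} (hq : 2 ≤ q) (hd : 0 ≤ d) (hdq : d ≤ q)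
    (h : c * q - a * d = 1) : rpt ((a : ℚ) / (q : ℚ)) = (c : ℚ) / (d : ℚ) := by
  have := lpt_div_eq (a := -a) (c := -c) hq hd hdq (by linarith)
  rw [rpt_eq_neg_lpt_neg, ← neg_div]
  push_cast at this
  rw [this]
  ring

lemma gaussMap_iterate_mem (α : ℝ) (hα : α ∈ Set.Ioo (0 : ℝ) 1) (hirr : Irrational α) (k : ℕ) :
    gaussMap^[k] α ∈ Set.Ioo (0 : ℝ) 1 ∧ Irrational (gaussMap^[k] α) := by
  induction k with
  | zero => exact ⟨hα, hirr⟩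
  | succ k ih =>
    rw [Function.iterate_succ_apply']
    have hi : Irrational (gaussMap (gaussMap^[k] α)) := ih.2.inv.sub_intCast _
    exact ⟨⟨lt_of_le_of_ne (Int.fract_nonneg _) hi.ne_zero.symm, Int.fract_lt_one _⟩, hi⟩

lemma one_le_cfa (α : ℝ) (hα : α ∈ Set.Ioo (0 : ℝ) 1) (hirr : Irrational α) (k : ℕ) :
    1 ≤ cfa α (k + 1) := by
  have h := (gaussMap_iterate_mem α hα hirr k).1
  refine Int.le_floor.mpr ?_
  exact_mod_cast (one_lt_inv₀ h.1).mpr h.2 |>.le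

lemma cfpq_det (α : ℝ) (k : ℕ) :
    (cfpq α k).1 * (cfpq α (k + 1)).2 - (cfpq α (k + 1)).1 * (cfpq α k).2 = -(-1) ^ k := by
  induction k with
  | zero => simp [cfpq]
  | succ k ih =>
    rw [pow_succ]
    simp only [cfpq]
    linear_combination -ih

lemma cfpq_bounds (α : ℝ) (hα : α ∈ Set.Ioo (0 : ℝ) 1) (hirr : Irrational α) (k : ℕ) :
    0 ≤ (cfpq α (k + 1)).1 ∧ 0 ≤ (cfpq α (k + 1)).2 ∧
    0 ≤ (cfpq α (k + 2)).1 ∧ 1 ≤ (cfpq α (k + 2)).2 ∧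
    (cfpq α (k + 2)).1 ≤ (cfpq α (k + 2)).2 ∧
    (cfpq α (k + 2)).1 + (cfpq α (k + 1)).1 ≤ (cfpq α (k + 2)).2 + (cfpq α (k + 1)).2 := by
  induction k with
  | zero => simp [cfpq, cfa]
  | succ k ih =>
    obtain ⟨h1, h2, h3, h4, h5, h6⟩ := ih
    have ha := one_le_cfa α hα hirr k
    have hp : (cfpq α (k + 1 + 2)).1 =
      cfa α (k + 1) * (cfpq α (k + 2)).1 + (cfpq α (k + 1)).1 := rfl
    have hq : (cfpq α (k + 1 + 2)).2 =
      cfa α (k + 1) * (cfpq α (k + 2)).2 + (cfpq α (k + 1)).2 := rfl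
    rw [hp, hq]
    refine ⟨h3, zero_le_one.trans h4, by positivity, ?_, ?_, ?_⟩
    · nlinarith
    · nlinarith [mul_nonneg (sub_nonneg.mpr ha) (sub_nonneg.mpr h5)]
    · change _ + (cfpq α (k + 2)).1 ≤ _ + (cfpq α (k + 2)).2
      nlinarith [mul_nonneg (sub_nonneg.mpr ha) (sub_nonneg.mpr h5)]

/-- `α` as a Möbius transform of its `k`-th complete quotient. -/
lemma cfpq_complete_quotient (α : ℝ) (hα : α ∈ Set.Ioo (0 : ℝ) 1) (hirr : Irrational α) (k : ℕ) :
    α * ((gaussMap^[k] α)⁻¹ * (cfpq α (k + 2)).2 + (cfpq α (k + 1)).2) =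
      (gaussMap^[k] α)⁻¹ * (cfpq α (k + 2)).1 + (cfpq α (k + 1)).1 := by
  induction k with
  | zero =>
    have := hα.1.ne'
    simp [cfpq, cfa, this]
  | succ k ih =>
    have hg := (gaussMap_iterate_mem α hα hirr (k + 1)).1.1.ne'
    have hx : (gaussMap^[k] α)⁻¹ = cfa α (k + 1) + gaussMap^[k + 1] α := by
      rw [Function.iterate_succ_apply']
      exact (Int.floor_add_fract _).symm
    have hp : (cfpq α (k + 1 + 2)).1 =
      cfa α (k + 1) * (cfpq α (k + 2)).1 + (cfpq α (k + 1)).1 := rfl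
    have hq : (cfpq α (k + 1 + 2)).2 =
      cfa α (k + 1) * (cfpq α (k + 2)).2 + (cfpq α (k + 1)).2 := rfl
    rw [hx] at ih
    rw [hp, hq, show k + 1 + 1 = k + 2 from rfl]
    push_cast
    field_simp
    linear_combination ih

/-- **Lemma 4 (Haynes–Vaaler).**  Let `α ∈ ℝ/ℤ` be irrational and let
`β = (m pₙ₋₁ + pₙ₋₂)/(m qₙ₋₁ + qₙ₋₂)`, `1 ≤ m ≤ aₙ`, be a nonzero point of `E_n(α)`.
If `n` is odd then `β' = pₙ₋₁/qₙ₋₁`, `β'' = ((m-1) pₙ₋₁ + pₙ₋₂)/((m-1) qₙ₋₁ + qₙ₋₂)`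
and `α ∈ I(β',β)`; if `n` is even then `β' = ((m-1) pₙ₋₁ + pₙ₋₂)/((m-1) qₙ₋₁ + qₙ₋₂)`,
`β'' = pₙ₋₁/qₙ₋₁` and `α ∈ I(β,β'')`. -/
theorem convergent_neighbors (α : ℝ) (hα : α ∈ Set.Ioo (0:ℝ) 1) (hirr : Irrational α)
    (n : ℕ) (hn : 1 ≤ n) (m : ℤ) (hm1 : 1 ≤ m) (hm2 : m ≤ cfa α n)
    (hne : cfE α n m ≠ 0) :
    (Odd n →
      lpt (cfE α n m) = (((cfpq α (n+1)).1 : ℚ) / ((cfpq α (n+1)).2 : ℚ)) ∧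
      rpt (cfE α n m) =
        ((((m-1) * (cfpq α (n+1)).1 + (cfpq α n).1 : ℤ) : ℚ) /
         (((m-1) * (cfpq α (n+1)).2 + (cfpq α n).2 : ℤ) : ℚ)) ∧
      α ∈ Set.Ioo ((lpt (cfE α n m) : ℚ) : ℝ) ((cfE α n m : ℚ) : ℝ)) ∧
    (Even n →
      lpt (cfE α n m) =
        ((((m-1) * (cfpq α (n+1)).1 + (cfpq α n).1 : ℤ) : ℚ) /
         (((m-1) * (cfpq α (n+1)).2 + (cfpq α n).2 : ℤ) : ℚ)) ∧
      rpt (cfE α n m) = (((cfpq α (n+1)).1 : ℚ) / ((cfpq α (n+1)).2 : ℚ)) ∧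
      α ∈ Set.Ioo ((cfE α n m : ℚ) : ℝ) ((rpt (cfE α n m) : ℚ) : ℝ)) := by
  obtain ⟨k, rfl⟩ : ∃ k, n = k + 1 := ⟨n - 1, by omega⟩
  obtain ⟨h1, h2, h3, h4, h5, h6⟩ := cfpq_bounds α hα hirr k
  have hdet := cfpq_det α (k + 1)
  have hmob := cfpq_complete_quotient α hα hirr k
  have hx : (m : ℝ) < (gaussMap^[k] α)⁻¹ :=
    lt_of_le_of_ne (Int.le_floor.mp hm2)
      ((gaussMap_iterate_mem α hα hirr k).2.inv.ne_int m).symm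
  unfold cfE at hne ⊢
  rw [show k + 1 + 1 = k + 2 from rfl] at *
  generalize (gaussMap^[k] α)⁻¹ = x at hmob hx
  generalize (cfpq α (k + 2)).1 = p₁ at *
  generalize (cfpq α (k + 2)).2 = q₁ at *
  generalize (cfpq α (k + 1)).1 = p₀ at *
  generalize (cfpq α (k + 1)).2 = q₀ at *
  obtain ⟨P, hP⟩ : ∃ P, P = m * p₁ + p₀ := ⟨_, rfl⟩
  obtain ⟨Q, hQ⟩ : ∃ Q, Q = m * q₁ + q₀ := ⟨_, rfl⟩
  rw [← hP, ← hQ] at hne ⊢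
  have hP0 : 0 ≤ P := by
    rw [hP]
    exact add_nonneg (mul_nonneg (by omega) h3) h1
  have hPQ : P ≤ Q := by nlinarith [mul_nonneg (sub_nonneg.mpr hm1) (sub_nonneg.mpr h5)]
  have hq₁Q : q₁ ≤ Q := by nlinarith
  have hQ0 : (0 : ℚ) < Q := by exact_mod_cast (by omega : 0 < Q)
  have hPQ' : P < Q := by
    refine lt_of_le_of_ne hPQ fun h => hne ?_
    rw [h, div_self hQ0.ne', Int.fract_one]
  have hQ2 : 2 ≤ Q := by
    by_contra! h
    obtain rfl : P = 0 := by omega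
    simp at hne
  have hfract : Int.fract ((P : ℚ) / (Q : ℚ)) = (P : ℚ) / (Q : ℚ) :=
    Int.fract_eq_self.mpr ⟨by positivity, (div_lt_one hQ0).mpr (by exact_mod_cast hPQ')⟩
  rw [hfract]
  have hd0 : 0 ≤ (m - 1) * q₁ + q₀ :=
    add_nonneg (mul_nonneg (by omega) (by omega)) h2
  have hdQ : (m - 1) * q₁ + q₀ ≤ Q := by linarith
  have hq₁R : (1 : ℝ) ≤ q₁ := by exact_mod_cast h4
  have hq₀R : (0 : ℝ) ≤ q₀ := by exact_mod_cast h2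
  have hmR : (1 : ℝ) ≤ m := by exact_mod_cast hm1
  have hden : 0 < x * q₁ + q₀ := by nlinarith
  have hQR : (0 : ℝ) < Q := by exact_mod_cast hQ0
  have hPR : (P : ℝ) = m * p₁ + p₀ := by exact_mod_cast hP
  have hQR' : (Q : ℝ) = m * q₁ + q₀ := by exact_mod_cast hQ
  have hkey : (α * q₁ - p₁) * (x * q₁ + q₀) = p₀ * q₁ - p₁ * q₀ := by
    linear_combination (q₁ : ℝ) * hmob
  have hdiff : P - α * Q = (x - m) * (α * q₁ - p₁) := by
    rw [hPR, hQR']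
    linear_combination -hmob
  constructor
  · intro hodd
    rw [hodd.neg_one_pow, neg_neg] at hdet
    have hl : lpt ((P : ℚ) / Q) = (p₁ : ℚ) / q₁ :=
      lpt_div_eq hQ2 (by omega) hq₁Q (by rw [hP, hQ]; linear_combination hdet)
    have hdetR : (p₀ : ℝ) * q₁ - p₁ * q₀ = 1 := by exact_mod_cast hdet
    have he : 0 < α * q₁ - p₁ := by
      refine pos_of_mul_pos_left ?_ hden.le
      rw [hkey, hdetR]
      exact one_pos
    refine ⟨hl, rpt_div_eq hQ2 hd0 hdQ (by rw [hP, hQ]; linear_combination hdet), ?_, ?_⟩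
    · rw [hl]
      push_cast
      rw [div_lt_iff₀ (by linarith)]
      linarith
    · push_cast
      rw [lt_div_iff₀ hQR]
      linarith [mul_pos (sub_pos.mpr hx) he]
  · intro heven
    rw [heven.neg_one_pow] at hdet
    have hr : rpt ((P : ℚ) / Q) = (p₁ : ℚ) / q₁ :=
      rpt_div_eq hQ2 (by omega) hq₁Q (by rw [hP, hQ]; linear_combination -hdet)
    have hdetR : (p₀ : ℝ) * q₁ - p₁ * q₀ = -1 := by exact_mod_cast hdet
    have he : 0 < p₁ - α * q₁ := by
      refine pos_of_mul_pos_left (b := x * q₁ + q₀) ?_ hden.le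
      linarith
    refine ⟨lpt_div_eq hQ2 hd0 hdQ (by rw [hP, hQ]; linear_combination -hdet), hr, ?_, ?_⟩
    · push_cast
      rw [div_lt_iff₀ hQR]
      linarith [mul_pos (sub_pos.mpr hx) he]
    · rw [hr]
      push_cast
      rw [lt_div_iff₀ (by linarith)]
      linarith

end
end

section
/- Let β₁, β₂, … be an admissible enumeration of ℚ/ℤ. Then the sequence {(f_{β_n}, B_n) : n = 1, 2, …} is a sequence of martingale differences: for each n the function f_{β_n} is B_n-measurable, and the conditional expectation of f_{β_{n+1}} with respect to B_n vanishes almost everywhere; equivalently, ∫_J f_{β_{n+1}}(x) dx = 0 for every component J of the open set (ℝ/ℤ)∖{β₁, …, β_n}. -/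
open MeasureTheory Filter Set

noncomputable section

/-- `e` (restricted to indices `n ≥ 1`) is an enumeration `β₁, β₂, …` of `ℚ/ℤ`
(whose elements are realized as the rationals in `[0,1)`). -/
def IsEnumeration (e : ℕ → ℚ) : Prop :=
  (∀ n, 1 ≤ n → e n ∈ Set.Ico (0:ℚ) 1) ∧
  (∀ m n, 1 ≤ m → 1 ≤ n → e m = e n → m = n) ∧
  (∀ β ∈ Set.Ico (0:ℚ) 1, ∃ n, 1 ≤ n ∧ e n = β)

/-- The enumeration `β₁, β₂, …` is admissible: `β₁ = 0`, and for `m ≥ 2`, `β_k = β_m'`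
implies `k < m` and `β_l = β_m''` implies `l < m`.  (`Int.fract` reduces the Farey
neighbours, which lie in `[0,1]`, to their coset representatives in `[0,1)`.) -/
def IsAdmissible (e : ℕ → ℚ) : Prop :=
  e 1 = 0 ∧
  (∀ m, 2 ≤ m → ∀ k, 1 ≤ k → e k = Int.fract (lpt (e m)) → k < m) ∧
  (∀ m, 2 ≤ m → ∀ l, 1 ≤ l → e l = Int.fract (rpt (e m)) → l < m)

/-- `J` is a connected component of `(ℝ/ℤ) ∖ S`, for a finite set `S` of points of `ℚ/ℤ`
realized as rationals in `[0,1)`; the circle `ℝ/ℤ` is realized as `[0,1) ⊆ ℝ`.  Either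
`J` is an open interval between two points of `S` consecutive in `[0,1)`, or `J` is the
wrap-around component running from the largest point of `S` through `0` to the smallest
point of `S`. -/
def isCircComponent (S : Finset ℚ) (J : Set ℝ) : Prop :=
  (∃ a ∈ S, ∃ b ∈ S, a < b ∧ (∀ c ∈ S, c ≤ a ∨ b ≤ c) ∧
      J = Set.Ioo ((a : ℚ) : ℝ) ((b : ℚ) : ℝ)) ∨
  (∃ a ∈ S, ∃ b ∈ S, (∀ c ∈ S, b ≤ c ∧ c ≤ a) ∧
      J = Set.Ioo ((a : ℚ) : ℝ) 1 ∪ Set.Ico 0 ((b : ℚ) : ℝ))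

/-- The finite σ-algebra `B_n` generated by the components of `(ℝ/ℤ) ∖ {β₁, …, β_n}`
together with the singletons `{β₁}, …, {β_n}` (as a σ-algebra of subsets of `ℝ`; its
trace on `[0,1) ≅ ℝ/ℤ` is the σ-algebra of the paper). -/
def bsig (e : ℕ → ℚ) (n : ℕ) : MeasurableSpace ℝ :=
  MeasurableSpace.generateFrom
    ({J | isCircComponent ((Finset.Icc 1 n).image e) J} ∪
     {J | ∃ k, 1 ≤ k ∧ k ≤ n ∧ J = {((e k : ℚ) : ℝ)}})

theorem saw_sub_eq {x c : ℝ} (hx : x ∈ Set.Ioo (0 : ℝ) 1) (hc : c ∈ Set.Icc (0 : ℝ) 1)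
    (hxc : x ≠ c) : saw (x - c) = x - c + (if x < c then 1 else 0) - 1 / 2 := by
  obtain ⟨hx0, hx1⟩ := hx
  obtain ⟨hc0, hc1⟩ := hc
  have key : Int.fract (x - c) = x - c + (if x < c then 1 else 0) := by
    rw [Int.fract_eq_iff]
    split_ifs with h
    · exact ⟨by linarith, by linarith, -1, by push_cast; ring⟩
    · push Not at h
      exact ⟨by linarith, by linarith, 0, by push_cast; ring⟩
  have hne : x - c + (if x < c then 1 else 0) ≠ (0 : ℝ) := by
    split_ifs with h
    · linarith
    · intro h0
      exact hxc (by linarith)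
  rw [saw, key, if_neg hne]

theorem num_den_of_det {β γ : ℚ} {a q : ℤ} (hq : 0 < q)
    (h : β.num * q - β.den * a = 1 ∨ a * β.den - β.num * q = 1) (hγ : γ = a / q) :
    γ.num = a ∧ (γ.den : ℤ) = q := by
  have hcop : IsCoprime a q := by
    rcases h with h | h
    · exact ⟨-β.den, β.num, by linarith⟩
    · exact ⟨β.den, -β.num, by linarith⟩
  have hcop' : a.natAbs.Coprime q.natAbs := Int.isCoprime_iff_gcd_eq_one.mp hcop
  subst hγ
  exact ⟨Rat.num_div_eq_of_coprime hq hcop', Rat.den_div_eq_of_coprime hq hcop'⟩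

/-- A reduced fraction in `(0, 1)` is the mediant of its Farey neighbours, and is adjacent to
both of them. -/
theorem farey_neighbours {β : ℚ} (h0 : 0 < β) (h1 : β < 1) :
    β.num * (lpt β).den - β.den * (lpt β).num = 1 ∧
    (rpt β).num * β.den - β.num * (rpt β).den = 1 ∧
    ((lpt β).den : ℤ) + (rpt β).den = β.den ∧
    (lpt β).num + (rpt β).num = β.num := by
  have hnum : 0 < β.num := Rat.num_pos.mpr h0
  have hden : 0 < β.den := β.den_pos
  have hnd : β.num < β.den := by simpa using (Rat.lt_iff β 1).mp h1
  have hq : 1 < β.den := by omega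
  have : NeZero β.den := ⟨hden.ne'⟩
  have : Fact (1 < β.den) := ⟨hq⟩
  have hu : IsUnit ((β.num : ℤ) : ZMod β.den) := by
    have hc : IsCoprime β.num (β.den : ℤ) := by
      rw [Int.isCoprime_iff_gcd_eq_one]
      exact β.reduced
    obtain ⟨u, v, huv⟩ := hc
    refine IsUnit.of_mul_eq_one (u : ZMod β.den) ?_
    have := congrArg (Int.cast : ℤ → ZMod β.den) huv
    push_cast at this
    rw [ZMod.natCast_self] at this
    rw [← this]; ring
  have hune : ((β.num : ℤ) : ZMod β.den)⁻¹ ≠ 0 := by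
    intro h
    have := ZMod.mul_inv_of_unit _ hu
    rw [h, mul_zero] at this
    exact zero_ne_one this
  have hinv : (((-β.num : ℤ) : ZMod β.den))⁻¹ = -((β.num : ZMod β.den)⁻¹) := by
    have e1 := ZMod.mul_inv_of_unit _ hu
    have hu' : IsUnit ((-β.num : ℤ) : ZMod β.den) := by push_cast; exact hu.neg
    have e2 := ZMod.mul_inv_of_unit _ hu'
    apply hu'.mul_left_cancel
    rw [e2]
    push_cast
    rw [neg_mul_neg, e1]
  have hl0 : 0 < lden β := by
    rw [lden, Nat.pos_iff_ne_zero, Ne, ZMod.val_eq_zero]; exact hune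
  have hl1 : lden β < β.den := ZMod.val_lt _
  have hsum : lden β + rden β = β.den := by
    have : NeZero ((β.num : ZMod β.den)⁻¹) := ⟨hune⟩
    have : rden β = β.den - lden β := by
      rw [rden, hinv, ZMod.val_neg_of_ne_zero, lden]
    omega
  have hdvd : (β.den : ℤ) ∣ β.num * lden β - 1 := by
    rw [← ZMod.intCast_zmod_eq_zero_iff_dvd]
    push_cast
    rw [lden, ZMod.natCast_zmod_val, ZMod.mul_inv_of_unit _ hu, sub_self]
  obtain ⟨a', ha'⟩ := hdvd
  have hsumz : (lden β : ℤ) + rden β = β.den := by exact_mod_cast hsum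
  have ha'' : β.num * rden β + 1 = β.den * (β.num - a') := by
    have : (rden β : ℤ) = β.den - lden β := by linarith
    rw [this]; linear_combination -ha'
  have hdq : (β.den : ℚ) ≠ 0 := by exact_mod_cast hden.ne'
  have hlq : (lden β : ℚ) ≠ 0 := by exact_mod_cast hl0.ne'
  have hr0 : 0 < rden β := by omega
  have hrq : (rden β : ℚ) ≠ 0 := by exact_mod_cast hr0.ne'
  have hl : lpt β = (a' : ℚ) / ((lden β : ℤ) : ℚ) := by
    rw [lpt, ha']; push_cast; field_simp
  have hr : rpt β = ((β.num - a' : ℤ) : ℚ) / ((rden β : ℤ) : ℚ) := by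
    rw [rpt, ha'']; push_cast; field_simp
  have d1 : β.num * (lden β : ℤ) - β.den * a' = 1 := by linarith
  have d2 : (β.num - a') * (β.den : ℤ) - β.num * rden β = 1 := by linarith
  obtain ⟨n1, m1⟩ := num_den_of_det (β := β) (by exact_mod_cast hl0) (Or.inl d1) hl
  obtain ⟨n2, m2⟩ := num_den_of_det (β := β) (by exact_mod_cast hr0) (Or.inr d2) hr
  rw [n1, m1, n2, m2]
  exact ⟨d1, d2, hsumz, by ring⟩

theorem lpt_lt {β : ℚ} (h0 : 0 < β) (h1 : β < 1) : lpt β < β := by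
  rw [Rat.lt_iff]
  linarith [(farey_neighbours h0 h1).1]

theorem lt_rpt {β : ℚ} (h0 : 0 < β) (h1 : β < 1) : β < rpt β := by
  rw [Rat.lt_iff]
  linarith [(farey_neighbours h0 h1).2.1]

theorem lpt_nonneg {β : ℚ} (h0 : 0 < β) (h1 : β < 1) : 0 ≤ lpt β := by
  have h := (farey_neighbours h0 h1).1
  have hn : 0 < β.num := Rat.num_pos.mpr h0
  have hd : (0 : ℤ) < β.den := by exact_mod_cast β.den_pos
  have hd' : (0 : ℤ) < (lpt β).den := by exact_mod_cast (lpt β).den_pos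
  rw [← Rat.num_nonneg]
  by_contra! hneg
  nlinarith

theorem rpt_le_one {β : ℚ} (h0 : 0 < β) (h1 : β < 1) : rpt β ≤ 1 := by
  have h := (farey_neighbours h0 h1).2.1
  have hd : (0 : ℤ) < β.den := by exact_mod_cast β.den_pos
  have hd' : (0 : ℤ) < (rpt β).den := by exact_mod_cast (rpt β).den_pos
  have hnd : β.num < β.den := by simpa using (Rat.lt_iff β 1).mp h1
  rw [Rat.le_iff]
  simp only [Rat.den_one, Rat.num_one, Nat.cast_one, mul_one, one_mul]
  by_contra! hgt
  nlinarith

/-- A fraction strictly between two adjacent fractions has denominator at least the sum of their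
denominators. -/
theorem den_add_den_le {u v γ : ℚ} (hdet : v.num * u.den - u.num * v.den = 1)
    (hu : u < γ) (hv : γ < v) : u.den + v.den ≤ γ.den := by
  rw [Rat.lt_iff] at hu hv
  have hud : (0 : ℤ) < u.den := by exact_mod_cast u.den_pos
  have hvd : (0 : ℤ) < v.den := by exact_mod_cast v.den_pos
  have key : (γ.den : ℤ) = (γ.num * u.den - u.num * γ.den) * v.den
      + (v.num * γ.den - γ.num * v.den) * u.den := by
    linear_combination (-(γ.den : ℤ)) * hdet
  have : (u.den : ℤ) + v.den ≤ γ.den := by nlinarith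
  exact_mod_cast this

theorem rpt_le_of_lt {β γ : ℚ} (h0 : 0 < β) (h1 : β < 1) (hl : lpt β < γ) (hr : γ < β) :
    rpt γ ≤ β := by
  have hγ0 := (lpt_nonneg h0 h1).trans_lt hl
  have hγ1 := hr.trans h1
  by_contra! hlt
  have e1 := den_add_den_le (by linarith [(farey_neighbours h0 h1).1]) hl hr
  have e2 := den_add_den_le (farey_neighbours hγ0 hγ1).2.1 hr hlt
  have := (rpt γ).den_pos
  omega

theorem le_lpt_of_lt {β γ : ℚ} (h0 : 0 < β) (h1 : β < 1) (hl : β < γ) (hr : γ < rpt β) :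
    β ≤ lpt γ := by
  have hγ0 := h0.trans hl
  have hγ1 := hr.trans_le (rpt_le_one h0 h1)
  by_contra! hlt
  have e1 := den_add_den_le (farey_neighbours h0 h1).2.1 hl hr
  have e2 := den_add_den_le (by linarith [(farey_neighbours hγ0 hγ1).1]) hlt hl
  have := (lpt γ).den_pos
  omega

/-- In an admissible enumeration, the point `e m` precedes every other point lying strictly
between its two Farey neighbours. -/
theorem index_le_of_mem_Ioo {e : ℕ → ℚ} (he : IsEnumeration e) (hadm : IsAdmissible e) {m : ℕ}
    (hm : 1 ≤ m) (hm0 : 0 < e m) (k : ℕ) (hk : 1 ≤ k)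
    (hmem : e k ∈ Set.Ioo (lpt (e m)) (rpt (e m))) : m ≤ k := by
  have hm1 : e m < 1 := (he.1 m hm).2
  induction k using Nat.strong_induction_on with
  | _ k ih =>
  obtain ⟨hl, hr⟩ := hmem
  have hk0 : 0 < e k := (lpt_nonneg hm0 hm1).trans_lt hl
  have hk1 : e k < 1 := (he.1 k hk).2
  have hk2 : 2 ≤ k := by
    by_contra! h
    obtain rfl : k = 1 := by omega
    exact hk0.ne' hadm.1
  rcases lt_trichotomy (e k) (e m) with h | h | h
  · have hle := rpt_le_of_lt hm0 hm1 hl h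
    have hlt := lt_rpt hk0 hk1
    obtain ⟨j, hj, hej⟩ := he.2.2 (rpt (e k)) ⟨(hk0.trans hlt).le, hle.trans_lt hm1⟩
    have hjk : j < k := hadm.2.2 k hk2 j hj
      (by rw [hej, Int.fract_eq_self.mpr ⟨(hk0.trans hlt).le, hle.trans_lt hm1⟩])
    exact (ih j hjk hj (by
      rw [hej]; exact ⟨hl.trans hlt, hle.trans_lt (lt_rpt hm0 hm1)⟩)).trans hjk.le
  · exact (he.2.1 k m hk hm h).ge
  · have hle := le_lpt_of_lt hm0 hm1 h hr
    have hlt := lpt_lt hk0 hk1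
    obtain ⟨j, hj, hej⟩ := he.2.2 (lpt (e k)) ⟨hm0.le.trans hle, hlt.trans hk1⟩
    have hjk : j < k := hadm.2.1 k hk2 j hj
      (by rw [hej, Int.fract_eq_self.mpr ⟨hm0.le.trans hle, hlt.trans hk1⟩])
    exact (ih j hjk hj (by
      rw [hej]; exact ⟨(lpt_lt hm0 hm1).trans_le hle, hlt.trans hr⟩)).trans hjk.le

theorem fb_eq {β : ℚ} (h0 : 0 < β) (h1 : β < 1) {x : ℝ} (hx : x ∈ Set.Ioo (0 : ℝ) 1)
    (hβ : x ≠ β) (hl : x ≠ lpt β) (hr : x ≠ rpt β) :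
    fb β x = β.den * (if x < β then 1 else 0) - (lpt β).den * (if x < lpt β then 1 else 0)
      - (rpt β).den * (if x < rpt β then 1 else 0) := by
  have icc : ∀ c : ℚ, 0 ≤ c → c ≤ 1 → (c : ℝ) ∈ Set.Icc (0 : ℝ) 1 := fun c hc hc' =>
    ⟨by exact_mod_cast hc, by exact_mod_cast hc'⟩
  have mul_den : ∀ c : ℚ, (c.den : ℝ) * (c : ℝ) = c.num := fun c => by
    exact_mod_cast Rat.den_mul_eq_num c
  rw [fb, if_neg h0.ne', saw_sub_eq hx (icc _ h0.le h1.le) hβ,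
    saw_sub_eq hx (icc _ (lpt_nonneg h0 h1) ((lpt_lt h0 h1).trans h1).le) hl,
    saw_sub_eq hx (icc _ (h0.trans (lt_rpt h0 h1)).le (rpt_le_one h0 h1)) hr]
  have d : ((lpt β).den : ℝ) + (rpt β).den = β.den := by
    exact_mod_cast (farey_neighbours h0 h1).2.2.1
  have n : ((lpt β).num : ℝ) + (rpt β).num = β.num := by
    exact_mod_cast (farey_neighbours h0 h1).2.2.2
  linear_combination -(x - 1 / 2) * d + n - mul_den β + mul_den (lpt β) + mul_den (rpt β)

theorem isCircComponent.eq_Ioo {S : Finset ℚ} {J : Set ℝ} (hJ : isCircComponent S J)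
    (h0 : 0 ∈ S) (hS : ∀ c ∈ S, c ∈ Set.Ico (0 : ℚ) 1) :
    ∃ a b : ℚ, a ∈ S ∧ (b ∈ S ∨ b = 1) ∧ a < b ∧ (∀ c, c ∈ S ∨ c = 1 → c ≤ a ∨ b ≤ c) ∧
      J = Set.Ioo (a : ℝ) b := by
  rcases hJ with ⟨a, ha, b, hb, hab, hc, rfl⟩ | ⟨a, ha, b, hb, hc, rfl⟩
  · refine ⟨a, b, ha, Or.inl hb, hab, ?_, rfl⟩
    rintro c (h | rfl)
    · exact hc c h
    · exact Or.inr (hS b hb).2.le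
  · obtain rfl : b = 0 := le_antisymm (hc 0 h0).1 (hS b hb).1
    refine ⟨a, 1, ha, Or.inr rfl, (hS a ha).2, ?_, by simp⟩
    rintro c (h | rfl)
    · exact Or.inl (hc c h).2
    · exact Or.inr le_rfl

theorem exists_isCircComponent_mem {S : Finset ℚ} (h0 : 0 ∈ S)
    (hS : ∀ c ∈ S, c ∈ Set.Ico (0 : ℚ) 1) {x : ℝ} (hx : x ∈ Set.Ico (0 : ℝ) 1)
    (hxS : ∀ c ∈ S, x ≠ (c : ℝ)) : ∃ J, isCircComponent S J ∧ x ∈ J := by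
  obtain ⟨a, ha, hamax⟩ := (S.filter fun c : ℚ => (c : ℝ) < x).exists_max_image id
    ⟨0, by simpa [h0] using lt_of_le_of_ne hx.1 (by simpa using (hxS 0 h0).symm)⟩
  simp only [Finset.mem_filter, id, and_imp] at ha hamax
  by_cases hne : (S.filter fun c : ℚ => x < (c : ℝ)).Nonempty
  · obtain ⟨b, hb, hbmin⟩ := (S.filter fun c : ℚ => x < (c : ℝ)).exists_min_image id hne
    simp only [Finset.mem_filter, id, and_imp] at hb hbmin
    refine ⟨_, Or.inl ⟨a, ha.1, b, hb.1, by exact_mod_cast ha.2.trans hb.2, fun c hc => ?_, rfl⟩,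
      ha.2, hb.2⟩
    rcases lt_or_gt_of_ne (hxS c hc) with h | h
    · exact Or.inr (hbmin c hc h)
    · exact Or.inl (hamax c hc h)
  · refine ⟨_, Or.inr ⟨a, ha.1, 0, h0, fun c hc => ⟨(hS c hc).1, ?_⟩, rfl⟩, Or.inl ⟨ha.2, hx.2⟩⟩
    rcases lt_or_gt_of_ne (hxS c hc) with h | h
    · exact absurd ⟨c, by simp [hc, h]⟩ hne
    · exact hamax c hc h

theorem finite_setOf_isCircComponent (S : Finset ℚ) : {J | isCircComponent S J}.Finite := by
  refine (((S ×ˢ S).image fun p => Set.Ioo (p.1 : ℝ) (p.2 : ℝ)).finite_toSet.union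
    ((S ×ˢ S).image fun p =>
      Set.Ioo (p.1 : ℝ) 1 ∪ Set.Ico 0 (p.2 : ℝ)).finite_toSet).subset ?_
  rintro J (⟨a, ha, b, hb, -, -, rfl⟩ | ⟨a, ha, b, hb, -, rfl⟩)
  · exact Or.inl (by
      rw [Finset.mem_coe, Finset.mem_image]
      exact ⟨(a, b), Finset.mk_mem_product ha hb, rfl⟩)
  · exact Or.inr (by
      rw [Finset.mem_coe, Finset.mem_image]
      exact ⟨(a, b), Finset.mk_mem_product ha hb, rfl⟩)

/-- A function constant on each member of a countable cover is measurable for the trace of the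
σ-algebra which the cover generates. -/
theorem measurable_comap_generateFrom {α : Type*} {s : Set α} {G : Set (Set α)} (hG : G.Countable)
    (hcover : ∀ x ∈ s, ∃ C ∈ G, x ∈ C) {g : α → ℝ}
    (hg : ∀ C ∈ G, ∀ x ∈ C, ∀ y ∈ C, g x = g y) :
    @Measurable s ℝ (MeasurableSpace.comap Subtype.val (MeasurableSpace.generateFrom G))
      Real.measurableSpace (fun x => g x) := by
  intro A _
  refine ⟨⋃₀ {C ∈ G | C ⊆ g ⁻¹' A}, ?_, ?_⟩
  · exact @MeasurableSet.sUnion _ (MeasurableSpace.generateFrom G) _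
      (hG.mono fun C hC => hC.1)
      fun C hC => MeasurableSpace.measurableSet_generateFrom hC.1
  · ext ⟨x, hx⟩
    simp only [Set.mem_preimage, Set.mem_sUnion, Set.mem_ofPred_eq]
    constructor
    · rintro ⟨C, ⟨-, hCA⟩, hxC⟩
      exact hCA hxC
    · intro hxA
      obtain ⟨C, hC, hxC⟩ := hcover x hx
      exact ⟨C, ⟨hC, fun y hy => by rw [Set.mem_preimage, hg C hC y hy x hxC]; exact hxA⟩, hxC⟩

/-- The Farey neighbours of `e m` occur, modulo `1`, among the earlier points of an admissible
enumeration. -/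
theorem neighbours_mem {e : ℕ → ℚ} (he : IsEnumeration e) (hadm : IsAdmissible e) {m : ℕ}
    (hm : 2 ≤ m) (h0 : 0 < e m) :
    (lpt (e m) ∈ (Finset.Icc 1 (m - 1)).image e ∨ lpt (e m) = 1) ∧
    (rpt (e m) ∈ (Finset.Icc 1 (m - 1)).image e ∨ rpt (e m) = 1) := by
  have h1 : e m < 1 := (he.1 m (by omega)).2
  have aux : ∀ c : ℚ, 0 ≤ c → c ≤ 1 → (∀ k, 1 ≤ k → e k = Int.fract c → k < m) →
      c ∈ (Finset.Icc 1 (m - 1)).image e ∨ c = 1 := by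
    intro c hc0 hc1 hc
    rcases hc1.lt_or_eq with h | h
    · obtain ⟨k, hk, hek⟩ := he.2.2 c ⟨hc0, h⟩
      have := hc k hk (by rw [hek, Int.fract_eq_self.mpr ⟨hc0, h⟩])
      exact Or.inl (Finset.mem_image.mpr ⟨k, Finset.mem_Icc.mpr ⟨hk, by omega⟩, hek⟩)
    · exact Or.inr h
  exact ⟨aux _ (lpt_nonneg h0 h1) ((lpt_lt h0 h1).trans h1).le (hadm.2.1 m hm),
    aux _ (h0.trans (lt_rpt h0 h1)).le (rpt_le_one h0 h1) (hadm.2.2 m hm)⟩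

theorem zero_mem_image {e : ℕ → ℚ} (hadm : IsAdmissible e) {n : ℕ} (hn : 1 ≤ n) :
    (0 : ℚ) ∈ (Finset.Icc 1 n).image e :=
  Finset.mem_image.mpr ⟨1, Finset.mem_Icc.mpr ⟨le_rfl, hn⟩, hadm.1⟩

theorem image_subset_Ico {e : ℕ → ℚ} (he : IsEnumeration e) {n : ℕ} (c : ℚ)
    (hc : c ∈ (Finset.Icc 1 n).image e) : c ∈ Set.Ico (0 : ℚ) 1 := by
  obtain ⟨k, hk, rfl⟩ := Finset.mem_image.mp hc
  exact he.1 k (Finset.mem_Icc.mp hk).1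

theorem pos_of_two_le {e : ℕ → ℚ} (he : IsEnumeration e) (hadm : IsAdmissible e) {m : ℕ}
    (hm : 2 ≤ m) : 0 < e m := by
  refine lt_of_le_of_ne (he.1 m (by omega)).1 fun h => ?_
  have := he.2.1 1 m le_rfl (by omega) (hadm.1.trans h)
  omega

theorem fb_const_on_component {e : ℕ → ℚ} (he : IsEnumeration e) (hadm : IsAdmissible e) {n : ℕ}
    (hn : 1 ≤ n) {J : Set ℝ} (hJ : isCircComponent ((Finset.Icc 1 n).image e) J) {x y : ℝ}
    (hx : x ∈ J) (hy : y ∈ J) : fb (e n) x = fb (e n) y := by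
  rcases hn.eq_or_lt with rfl | hn2
  · simp [fb, hadm.1]
  have h0 : 0 < e n := pos_of_two_le he hadm hn2
  have h1 : e n < 1 := (he.1 n hn).2
  obtain ⟨a, b, ha, hb, hab, hc, rfl⟩ :=
    hJ.eq_Ioo (zero_mem_image hadm hn) (image_subset_Ico he)
  have hsub : ∀ c : ℚ, c ∈ (Finset.Icc 1 (n - 1)).image e ∨ c = 1 → c ≤ a ∨ b ≤ c := by
    refine fun c h => hc c (h.imp_left fun h => ?_)
    exact Finset.image_subset_image (Finset.Icc_subset_Icc_right (by omega)) h
  have hl := hsub _ (neighbours_mem he hadm hn2 h0).1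
  have hr := hsub _ (neighbours_mem he hadm hn2 h0).2
  have hβ := hc (e n)
    (Or.inl (Finset.mem_image.mpr ⟨n, Finset.mem_Icc.mpr ⟨hn, le_rfl⟩, rfl⟩))
  have ha0 : (0 : ℝ) ≤ a := by exact_mod_cast (image_subset_Ico he a ha).1
  have hb1 : (b : ℝ) ≤ 1 := by
    rcases hb with hb | rfl
    · exact_mod_cast (image_subset_Ico he b hb).2.le
    · simp
  have side : ∀ c : ℚ, c ≤ a ∨ b ≤ c → ∀ z ∈ Set.Ioo (a : ℝ) b,
      z ≠ c ∧ (z < (c : ℝ) ↔ b ≤ c) := by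
    rintro c hc z ⟨hz1, hz2⟩
    rcases hc with h | h
    · have h' : (c : ℝ) ≤ a := by exact_mod_cast h
      exact ⟨(h'.trans_lt hz1).ne', iff_of_false (by linarith) (by linarith)⟩
    · have h' : (b : ℝ) ≤ c := by exact_mod_cast h
      exact ⟨(hz2.trans_le h').ne, iff_of_true (by linarith) h⟩
  have eval : ∀ z ∈ Set.Ioo (a : ℝ) b, fb (e n) z = (e n).den * (if b ≤ e n then 1 else 0)
      - (lpt (e n)).den * (if b ≤ lpt (e n) then 1 else 0)
      - (rpt (e n)).den * (if b ≤ rpt (e n) then 1 else 0) := by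
    intro z hz
    rw [fb_eq h0 h1 ⟨ha0.trans_lt hz.1, hz.2.trans_le hb1⟩ (side _ hβ z hz).1 (side _ hl z hz).1
      (side _ hr z hz).1]
    simp only [(side _ hβ z hz).2, (side _ hl z hz).2, (side _ hr z hz).2]
  rw [eval x hx, eval y hy]

theorem integral_fb_neighbours {β : ℚ} (h0 : 0 < β) (h1 : β < 1) :
    ∫ x in Set.Ioo (lpt β : ℝ) (rpt β), fb β x = 0 := by
  have hl : (lpt β : ℝ) < β := by exact_mod_cast lpt_lt h0 h1
  have hr : (β : ℝ) < rpt β := by exact_mod_cast lt_rpt h0 h1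
  have hl0 : (0 : ℝ) ≤ lpt β := by exact_mod_cast lpt_nonneg h0 h1
  have hr1 : (rpt β : ℝ) ≤ 1 := by exact_mod_cast rpt_le_one h0 h1
  obtain ⟨d1, d2, d3, -⟩ := farey_neighbours h0 h1
  have d3' : ((lpt β).den : ℝ) + (rpt β).den = β.den := by exact_mod_cast d3
  have left : Set.EqOn (fb β) (fun _ => ((lpt β).den : ℝ)) (Set.Ioo (lpt β : ℝ) β) := by
    rintro x ⟨hx1, hx2⟩
    rw [fb_eq h0 h1 ⟨by linarith, by linarith⟩ hx2.ne hx1.ne' (hx2.trans hr).ne, if_pos hx2,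
      if_neg hx1.not_gt, if_pos (hx2.trans hr)]
    linarith
  have right : Set.EqOn (fb β) (fun _ => -((rpt β).den : ℝ)) (Set.Ioo (β : ℝ) (rpt β)) := by
    rintro x ⟨hx1, hx2⟩
    rw [fb_eq h0 h1 ⟨by linarith, by linarith⟩ hx1.ne' (hl.trans hx1).ne' hx2.ne,
      if_neg hx1.not_gt, if_neg (hl.trans hx1).not_gt, if_pos hx2]
    ring
  have il : IntegrableOn (fb β) (Set.Ioo (lpt β : ℝ) β) :=
    (integrableOn_const (by simp)).congr_fun left.symm measurableSet_Ioo
  have ir : IntegrableOn (fb β) (Set.Ioo (β : ℝ) (rpt β)) :=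
    (integrableOn_const (by simp)).congr_fun right.symm measurableSet_Ioo
  rw [← integrableOn_Ioc_iff_integrableOn_Ioo] at il ir
  have hdβ : (β.den : ℝ) ≠ 0 := by exact_mod_cast β.den_pos.ne'
  have hdl : ((lpt β).den : ℝ) ≠ 0 := by exact_mod_cast (lpt β).den_pos.ne'
  have hdr : ((rpt β).den : ℝ) ≠ 0 := by exact_mod_cast (rpt β).den_pos.ne'
  rw [← integral_Ioc_eq_integral_Ioo, ← Set.Ioc_union_Ioc_eq_Ioc hl.le hr.le,
    setIntegral_union (Set.Ioc_disjoint_Ioc_of_le le_rfl) measurableSet_Ioc il ir,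
    integral_Ioc_eq_integral_Ioo, integral_Ioc_eq_integral_Ioo,
    setIntegral_congr_fun measurableSet_Ioo left, setIntegral_congr_fun measurableSet_Ioo right,
    setIntegral_const, setIntegral_const, Real.volume_real_Ioo_of_le hl.le,
    Real.volume_real_Ioo_of_le hr.le, smul_eq_mul, smul_eq_mul]
  have d1' : (β.num : ℝ) * (lpt β).den - β.den * (lpt β).num = 1 := by exact_mod_cast d1
  have d2' : ((rpt β).num : ℝ) * β.den - β.num * (rpt β).den = 1 := by exact_mod_cast d2
  have mul_den : ∀ c : ℚ, (c.den : ℝ) * (c : ℝ) = c.num := fun c => by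
    exact_mod_cast Rat.den_mul_eq_num c
  apply mul_left_cancel₀ hdβ
  rw [← mul_den, ← mul_den] at d1' d2'
  linear_combination d1' - d2'

theorem integral_fb_component {e : ℕ → ℚ} (he : IsEnumeration e) (hadm : IsAdmissible e) {n : ℕ}
    (hn : 1 ≤ n) {J : Set ℝ} (hJ : isCircComponent ((Finset.Icc 1 n).image e) J) :
    ∫ x in J, fb (e (n + 1)) x = 0 := by
  have h0 : 0 < e (n + 1) := pos_of_two_le he hadm (by omega)
  have h1 : e (n + 1) < 1 := (he.1 (n + 1) (by omega)).2
  obtain ⟨a, b, ha, hb, hab, hc, rfl⟩ :=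
    hJ.eq_Ioo (zero_mem_image hadm hn) (image_subset_Ico he)
  have hnb := neighbours_mem he hadm (m := n + 1) (by omega) h0
  rw [Nat.add_sub_cancel] at hnb
  have hl := hc _ hnb.1
  have hr := hc _ hnb.2
  have out : ∀ c : ℚ, c ∈ (Finset.Icc 1 n).image e ∨ c = 1 →
      c ≤ lpt (e (n + 1)) ∨ rpt (e (n + 1)) ≤ c := by
    rintro c (h | rfl)
    · obtain ⟨k, hk, rfl⟩ := Finset.mem_image.mp h
      rw [Finset.mem_Icc] at hk
      by_contra! hcon
      have := index_le_of_mem_Ioo he hadm (m := n + 1) (by omega) h0 k hk.1 hcon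
      omega
    · exact Or.inr (rpt_le_one h0 h1)
  have hlβ := lpt_lt h0 h1
  have hβr := lt_rpt h0 h1
  have ha0 : (0 : ℝ) ≤ a := by exact_mod_cast (image_subset_Ico he a ha).1
  have hb1 : (b : ℝ) ≤ 1 := by
    rcases hb with hb | rfl
    · exact_mod_cast (image_subset_Ico he b hb).2.le
    · simp
  have d : ((lpt (e (n + 1))).den : ℝ) + (rpt (e (n + 1))).den = (e (n + 1)).den := by
    exact_mod_cast (farey_neighbours h0 h1).2.2.1
  have hlβ' : (lpt (e (n + 1)) : ℝ) < e (n + 1) := by exact_mod_cast hlβ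
  have hβr' : (e (n + 1) : ℝ) < rpt (e (n + 1)) := by exact_mod_cast hβr
  have left_case : b ≤ lpt (e (n + 1)) → ∫ x in Set.Ioo (a : ℝ) b, fb (e (n + 1)) x = 0 := by
    intro h
    have h' : (b : ℝ) ≤ lpt (e (n + 1)) := by exact_mod_cast h
    refine setIntegral_eq_zero_of_forall_eq_zero fun x hx => ?_
    have x1 := hx.2.trans_le h'
    have x2 := x1.trans hlβ'
    have x3 := x2.trans hβr'
    rw [fb_eq h0 h1 ⟨ha0.trans_lt hx.1, hx.2.trans_le hb1⟩ x2.ne x1.ne x3.ne, if_pos x1,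
      if_pos x2, if_pos x3]
    linarith
  have right_case : rpt (e (n + 1)) ≤ a → ∫ x in Set.Ioo (a : ℝ) b, fb (e (n + 1)) x = 0 := by
    intro h
    have h' : (rpt (e (n + 1)) : ℝ) ≤ a := by exact_mod_cast h
    refine setIntegral_eq_zero_of_forall_eq_zero fun x hx => ?_
    have x1 := h'.trans_lt hx.1
    have x2 := hβr'.trans x1
    have x3 := hlβ'.trans x2
    rw [fb_eq h0 h1 ⟨ha0.trans_lt hx.1, hx.2.trans_le hb1⟩ x2.ne' x3.ne' x1.ne',
      if_neg x1.not_gt, if_neg x2.not_gt, if_neg x3.not_gt]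
    ring
  rcases hl with hl | hl
  · rcases hr with hr | hr
    · exact right_case hr
    · obtain rfl : a = lpt (e (n + 1)) := by
        rcases out a (Or.inl ha) with h | h
        · exact le_antisymm h hl
        · linarith
      obtain rfl : b = rpt (e (n + 1)) := by
        rcases out b hb with h | h
        · linarith
        · exact le_antisymm hr h
      exact integral_fb_neighbours h0 h1
  · exact left_case hl

/-- **Theorem 7 (Haynes–Vaaler).**  Let `β₁, β₂, …` be an admissible enumeration of
`ℚ/ℤ`.  Then `{(f_{β_n}, B_n) : n = 1, 2, …}` is a sequence of martingale differences:
each `f_{β_n}` is `B_n`-measurable, and `∫_J f_{β_{n+1}}(x) dx = 0` for every component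
`J` of `(ℝ/ℤ) ∖ {β₁, …, β_n}` (equivalently, the conditional expectation of `f_{β_{n+1}}`
with respect to `B_n` vanishes almost everywhere). -/
theorem admissible_martingale_differences (e : ℕ → ℚ) (he : IsEnumeration e)
    (hadm : IsAdmissible e) :
    (∀ n : ℕ, 1 ≤ n →
      @Measurable (Set.Ico (0:ℝ) 1) ℝ (MeasurableSpace.comap Subtype.val (bsig e n))
        Real.measurableSpace (fun x => fb (e n) (x : ℝ))) ∧
    (∀ n : ℕ, 1 ≤ n → ∀ J : Set ℝ, isCircComponent ((Finset.Icc 1 n).image e) J →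
      ∫ x in J, fb (e (n+1)) x = 0) := by
  refine ⟨fun n hn => ?_, fun n hn J hJ => integral_fb_component he hadm hn hJ⟩
  refine measurable_comap_generateFrom ?_ ?_ ?_
  · refine ((finite_setOf_isCircComponent _).union ?_).countable
    refine ((Set.finite_Icc 1 n).image fun k => ({((e k : ℚ) : ℝ)} : Set ℝ)).subset ?_
    rintro J ⟨k, hk1, hkn, rfl⟩
    exact ⟨k, ⟨hk1, hkn⟩, rfl⟩
  · intro x hx
    by_cases h : ∃ c ∈ (Finset.Icc 1 n).image e, x = (c : ℝ)
    · obtain ⟨c, hc, rfl⟩ := h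
      obtain ⟨k, hk, rfl⟩ := Finset.mem_image.mp hc
      exact ⟨_, Or.inr ⟨k, (Finset.mem_Icc.mp hk).1, (Finset.mem_Icc.mp hk).2, rfl⟩, rfl⟩
    · push Not at h
      obtain ⟨J, hJ, hxJ⟩ := exists_isCircComponent_mem (zero_mem_image hadm hn)
        (image_subset_Ico he) hx h
      exact ⟨J, Or.inl hJ, hxJ⟩
  · rintro C (hC | ⟨k, -, -, rfl⟩) x hx y hy
    · exact fb_const_on_component he hadm hn hC hx hy
    · rw [Set.mem_singleton_iff.mp hx, Set.mem_singleton_iff.mp hy]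

end
end
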